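/- (Uniqueness of canonical coordinates) Let x : D → ℝ⁴ be a smooth minimal time-like surface in canonical coordinates with parameters (ε₀,ε₁) ∈ {(1,0), (−1,0), (0,1)} on a connected open set D ⊆ ℝ², and let F : D' → D be a C² diffeomorphism from a connected open set D' ⊆ ℝ² such that x∘F is also a minimal time-like surface in canonical coordinates with the same parameters (ε₀,ε₁) and with Ẽ < 0. Then there exist δ ∈ {1,−1} and c = (c₁,c₂) ∈ ℝ² such that either F(u,v) = (δu + c₁, δv + c₂) for all (u,v) ∈ D', or — the latter possible only when ε₁ = 0 (first or second type) — F(u,v) = (δu + c₁, −δv + c₂) for all (u,v) ∈ D'. -/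

import Mathlib

noncomputable section

abbrev V4 : Type := Fin 4 → ℝ

/-- The indefinite scalar product of `ℝ⁴₂`. -/
def ip (a b : V4) : ℝ := -(a 0 * b 0) + a 1 * b 1 - a 2 * b 2 + a 3 * b 3

/-- Partial derivative w.r.t. the first variable. -/
def pu {E : Type*} [NormedAddCommGroup E] [NormedSpace ℝ E]
    (f : ℝ × ℝ → E) (p : ℝ × ℝ) : E := fderiv ℝ f p (1, 0)

/-- Partial derivative w.r.t. the second variable. -/
def pv {E : Type*} [NormedAddCommGroup E] [NormedSpace ℝ E]
    (f : ℝ × ℝ → E) (p : ℝ × ℝ) : E := fderiv ℝ f p (0, 1)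

/-- `E`, the first coefficient of the first fundamental form. -/
def Ef (x : ℝ × ℝ → V4) (p : ℝ × ℝ) : ℝ := ip (pu x p) (pu x p)

/-- Normal projection of a vector `w` at the point `p` of the surface `x`:
`w^⊥ = w − (⟨w,x_u⟩/E)·x_u + (⟨w,x_v⟩/E)·x_v`. -/
def nproj (x : ℝ × ℝ → V4) (w : V4) (p : ℝ × ℝ) : V4 :=
  w - (ip w (pu x p) / Ef x p) • pu x p + (ip w (pv x p) / Ef x p) • pv x p

/-- `a = (x_uu)^⊥`. -/
def sffA (x : ℝ × ℝ → V4) (p : ℝ × ℝ) : V4 := nproj x (pu (pu x) p) p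

/-- `b = (x_uv)^⊥`. -/
def sffB (x : ℝ × ℝ → V4) (p : ℝ × ℝ) : V4 := nproj x (pv (pu x) p) p

/-- Determinant of the 4×4 matrix with columns `v1, v2, v3, v4`. -/
def det4 (v1 v2 v3 v4 : V4) : ℝ := (Matrix.of ![v1, v2, v3, v4]).transpose.det

/-- The Gauss curvature `K = (⟨b,b⟩ − ⟨a,a⟩)/E²`. -/
def GaussK (x : ℝ × ℝ → V4) (p : ℝ × ℝ) : ℝ :=
  (ip (sffB x p) (sffB x p) - ip (sffA x p) (sffA x p)) / (Ef x p) ^ 2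

/-- The curvature of the normal connection `ϰ = −2·det[x_u,x_v,a,b]/E³`. -/
def NormK (x : ℝ × ℝ → V4) (p : ℝ × ℝ) : ℝ :=
  -2 * det4 (pu x p) (pv x p) (sffA x p) (sffB x p) / (Ef x p) ^ 3

/-- The hyperbolic Laplacian `Δʰ f = f_uu − f_vv`. -/
def hlap (f : ℝ × ℝ → ℝ) (p : ℝ × ℝ) : ℝ := pu (pu f) p - pv (pv f) p

/-- Time-like surface in isothermal coordinates with `E < 0`. -/
def IsTimelikeIso (D : Set (ℝ × ℝ)) (x : ℝ × ℝ → V4) : Prop :=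
  ∀ p ∈ D, Ef x p < 0 ∧ ip (pv x p) (pv x p) = -(Ef x p) ∧ ip (pu x p) (pv x p) = 0

/-- Minimality: `x_uu − x_vv = 0`. -/
def IsMinimal (D : Set (ℝ × ℝ)) (x : ℝ × ℝ → V4) : Prop :=
  ∀ p ∈ D, pu (pu x) p - pv (pv x) p = 0

/-- Degenerate point: `(⟨a,a⟩+⟨b,b⟩)² = 4⟨a,b⟩²`. -/
def DegeneratePt (x : ℝ × ℝ → V4) (p : ℝ × ℝ) : Prop :=
  (ip (sffA x p) (sffA x p) + ip (sffB x p) (sffB x p)) ^ 2 =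
    4 * (ip (sffA x p) (sffB x p)) ^ 2

/-- Surface of the first type. -/
def FirstType (D : Set (ℝ × ℝ)) (x : ℝ × ℝ → V4) : Prop :=
  ∀ p ∈ D,
    (ip (sffA x p) (sffA x p) + ip (sffB x p) (sffB x p)) ^ 2 -
      4 * (ip (sffA x p) (sffB x p)) ^ 2 > 0 ∧
    ip (sffA x p) (sffA x p) + ip (sffB x p) (sffB x p) > 0

/-- Surface of the second type. -/
def SecondType (D : Set (ℝ × ℝ)) (x : ℝ × ℝ → V4) : Prop :=
  ∀ p ∈ D,
    (ip (sffA x p) (sffA x p) + ip (sffB x p) (sffB x p)) ^ 2 -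
      4 * (ip (sffA x p) (sffB x p)) ^ 2 > 0 ∧
    ip (sffA x p) (sffA x p) + ip (sffB x p) (sffB x p) < 0

/-- Surface of the third type. -/
def ThirdType (D : Set (ℝ × ℝ)) (x : ℝ × ℝ → V4) : Prop :=
  ∀ p ∈ D,
    (ip (sffA x p) (sffA x p) + ip (sffB x p) (sffB x p)) ^ 2 -
      4 * (ip (sffA x p) (sffB x p)) ^ 2 < 0

/-- Canonical coordinates with parameters `(e0, e1)`:
`⟨a,a⟩+⟨b,b⟩ = e0` and `2⟨a,b⟩ = e1` identically. -/
def Canonical (D : Set (ℝ × ℝ)) (x : ℝ × ℝ → V4) (e0 e1 : ℝ) : Prop :=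
  ∀ p ∈ D,
    ip (sffA x p) (sffA x p) + ip (sffB x p) (sffB x p) = e0 ∧
    2 * ip (sffA x p) (sffB x p) = e1

lemma ip_comm (a b : V4) : ip a b = ip b a := by
  simp only [ip]; ring

lemma ip_add_left (a b c : V4) : ip (a + b) c = ip a c + ip b c := by
  simp only [ip, Pi.add_apply]; ring

lemma ip_smul_left (r : ℝ) (a b : V4) : ip (r • a) b = r * ip a b := by
  simp only [ip, Pi.smul_apply, smul_eq_mul]; ring

lemma ip_add_right (a b c : V4) : ip a (b + c) = ip a b + ip a c := by
  simp only [ip, Pi.add_apply]; ring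

lemma ip_smul_right (r : ℝ) (a b : V4) : ip a (r • b) = r * ip a b := by
  simp only [ip, Pi.smul_apply, smul_eq_mul]; ring

lemma fderiv_apply_eq_pu_pv {E : Type*} [NormedAddCommGroup E] [NormedSpace ℝ E]
    (f : ℝ × ℝ → E) (p h : ℝ × ℝ) :
    fderiv ℝ f p h = h.1 • pu f p + h.2 • pv f p := by
  rw [pu, pv, ← map_smul, ← map_smul, ← map_add]
  simp

/-- The derivatives of an orientation-preserving or -reversing conformal change between
isothermal coordinates with `E < 0` satisfy the (hyperbolic) Cauchy-Riemann equations. -/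
lemma hyperbolic_cauchy_riemann {p q r t E : ℝ} (hE : E < 0)
    (huu : E * (p ^ 2 - q ^ 2) < 0)
    (hvv : E * (r ^ 2 - t ^ 2) = -(E * (p ^ 2 - q ^ 2)))
    (huv : E * (p * r - q * t) = 0) :
    ∃ σ : ℝ, (σ = 1 ∨ σ = -1) ∧ r = σ * q ∧ t = σ * p := by
  have hpq : 0 < p ^ 2 - q ^ 2 := by nlinarith
  have h1 : r ^ 2 - t ^ 2 = -(p ^ 2 - q ^ 2) :=
    mul_left_cancel₀ hE.ne (by linarith)
  have h2 : p * r = q * t := by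
    have := (mul_eq_zero.mp huv).resolve_left hE.ne
    linarith
  have hp : p ≠ 0 := by
    rintro rfl
    nlinarith [sq_nonneg q]
  have ht : t ^ 2 = p ^ 2 := by
    have : (p ^ 2 - q ^ 2) * (t ^ 2 - p ^ 2) = 0 := by
      linear_combination (p * r + q * t) * h2 - p ^ 2 * h1
    have := (mul_eq_zero.mp this).resolve_left hpq.ne'
    linarith
  rcases sq_eq_sq_iff_eq_or_eq_neg.mp ht with rfl | rfl
  · exact ⟨1, Or.inl rfl, mul_left_cancel₀ hp (by linarith), by ring⟩
  · exact ⟨-1, Or.inr rfl, mul_left_cancel₀ hp (by linarith), by ring⟩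

/-- A change of coordinates preserving the canonical normalization is `±1` or `±` conjugation
at the infinitesimal level. -/
lemma canonical_rigidity {p q σ e0 e1 : ℝ} (hσ : σ = 1 ∨ σ = -1) (hpq : 0 < p ^ 2 - q ^ 2)
    (hpar : (e0, e1) = (1, 0) ∨ (e0, e1) = (-1, 0) ∨ (e0, e1) = (0, 1))
    (h0 : ((p ^ 2 + q ^ 2) ^ 2 + (2 * p * q) ^ 2) * e0
      + 2 * (p ^ 2 + q ^ 2) * (2 * p * q) * e1 = e0)
    (h1 : σ * (2 * (p ^ 2 + q ^ 2) * (2 * p * q) * e0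
      + ((p ^ 2 + q ^ 2) ^ 2 + (2 * p * q) ^ 2) * e1) = e1) :
    q = 0 ∧ (p = 1 ∨ p = -1) ∧ (e1 = 0 ∨ σ = 1) := by
  have hp : p ≠ 0 := by
    rintro rfl
    nlinarith [sq_nonneg q]
  have hP : 0 < p ^ 2 + q ^ 2 := by positivity
  have hσ0 : σ ≠ 0 := by rcases hσ with rfl | rfl <;> norm_num
  have key : q = 0 ∧ (p ^ 2 + q ^ 2) ^ 2 + (2 * p * q) ^ 2 = 1 ∧ (e1 = 0 ∨ σ = 1) := by
    have hq : ∀ {m : ℝ}, m = 2 * (p ^ 2 + q ^ 2) * (2 * p * q) → m = 0 → q = 0 := by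
      rintro m rfl hm
      simpa [hp, hP.ne'] using hm
    rcases hpar with h | h | h <;> obtain ⟨rfl, rfl⟩ := Prod.mk.inj h
    · have := (mul_eq_zero.mp (by simpa only [mul_zero, add_zero] using h1)).resolve_left hσ0
      exact ⟨hq rfl (by linarith), by linarith, Or.inl rfl⟩
    · have := (mul_eq_zero.mp (by simpa only [mul_zero, add_zero] using h1)).resolve_left hσ0
      exact ⟨hq rfl (by linarith), by linarith, Or.inl rfl⟩
    · have hS : 0 < (p ^ 2 + q ^ 2) ^ 2 + (2 * p * q) ^ 2 := by positivity
      refine ⟨hq rfl (by linarith), ?_⟩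
      rcases hσ with rfl | rfl
      · exact ⟨by linarith, Or.inr rfl⟩
      · linarith
  obtain ⟨rfl, hS, he⟩ := key
  refine ⟨rfl, ?_, he⟩
  have : (p ^ 2 - 1) * (p ^ 2 + 1) = 0 := by linear_combination hS
  have := (mul_eq_zero.mp this).resolve_right (by positivity)
  exact mul_self_eq_one_iff.mp (by linarith)

/-- The second derivative of a composition. -/
lemma fderiv_fderiv_comp_apply {E G H : Type*} [NormedAddCommGroup E] [NormedSpace ℝ E]
    [NormedAddCommGroup G] [NormedSpace ℝ G] [NormedAddCommGroup H] [NormedSpace ℝ H]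
    {x : G → H} {F : E → G} {s : E} (hx : ContDiffAt ℝ 2 x (F s)) (hF : ContDiffAt ℝ 2 F s)
    (v w : E) :
    fderiv ℝ (fun r => fderiv ℝ (fun t => x (F t)) r v) s w =
      fderiv ℝ (fderiv ℝ x) (F s) (fderiv ℝ F s w) (fderiv ℝ F s v) +
        fderiv ℝ x (F s) (fderiv ℝ (fderiv ℝ F) s w v) := by
  have hev : (fun r => fderiv ℝ (fun t => x (F t)) r v) =ᶠ[nhds s]
      fun r => fderiv ℝ x (F r) (fderiv ℝ F r v) := by
    filter_upwards [hF.continuousAt.eventually (hx.eventually (by simp)),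
      hF.eventually (by simp)] with r h1 h2
    exact congrArg (fun L => L v)
      (fderiv_comp r (h1.differentiableAt (by simp)) (h2.differentiableAt (by simp)))
  have hx1 : HasFDerivAt (fderiv ℝ x) (fderiv ℝ (fderiv ℝ x) (F s)) (F s) :=
    ((hx.fderiv_right (m := 1) (by norm_num)).differentiableAt (by simp)).hasFDerivAt
  have hF1 : HasFDerivAt (fderiv ℝ F) (fderiv ℝ (fderiv ℝ F) s) s :=
    ((hF.fderiv_right (m := 1) (by norm_num)).differentiableAt (by simp)).hasFDerivAt
  have hF0 : HasFDerivAt F (fderiv ℝ F s) s := (hF.differentiableAt (by simp)).hasFDerivAt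
  have h := (hx1.comp s hF0).clm_apply (hF1.clm_apply (hasFDerivAt_const v s))
  rw [hev.fderiv_eq]
  refine (congrArg (fun L => L w) h.fderiv).trans ?_
  simp [add_comm]

lemma fderiv_fderiv_apply {E H : Type*} [NormedAddCommGroup E] [NormedSpace ℝ E]
    [NormedAddCommGroup H] [NormedSpace ℝ H] {x : E → H} {p : E} (hx : ContDiffAt ℝ 2 x p)
    (v w : E) :
    fderiv ℝ (fun r => fderiv ℝ x r v) p w = fderiv ℝ (fderiv ℝ x) p w v := by
  have h : HasFDerivAt (fun r => fderiv ℝ x r v) _ p :=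
    ((hx.fderiv_right (m := 1) (by norm_num)).differentiableAt (by simp)).hasFDerivAt.clm_apply
      (hasFDerivAt_const v p)
  rw [h.fderiv]
  simp

/-- Second directional derivatives of a function in terms of iterated partial derivatives. -/
lemma fderiv_fderiv_eq_pu_pv {E : Type*} [NormedAddCommGroup E] [NormedSpace ℝ E]
    {x : ℝ × ℝ → E} {p : ℝ × ℝ} (hx : ContDiffAt ℝ 2 x p) (h k : ℝ × ℝ) :
    fderiv ℝ (fderiv ℝ x) p h k =
      (h.1 * k.1) • pu (pu x) p + (h.1 * k.2 + h.2 * k.1) • pv (pu x) p +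
        (h.2 * k.2) • pv (pv x) p := by
  have hsymm : fderiv ℝ (fderiv ℝ x) p (1, 0) (0, 1) = fderiv ℝ (fderiv ℝ x) p (0, 1) (1, 0) :=
    (hx.isSymmSndFDerivAt (by simp)) _ _
  have huu : pu (pu x) p = fderiv ℝ (fderiv ℝ x) p (1, 0) (1, 0) := fderiv_fderiv_apply hx _ _
  have hvu : pv (pu x) p = fderiv ℝ (fderiv ℝ x) p (0, 1) (1, 0) := fderiv_fderiv_apply hx _ _
  have hvv : pv (pv x) p = fderiv ℝ (fderiv ℝ x) p (0, 1) (0, 1) := fderiv_fderiv_apply hx _ _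
  have hh : h = h.1 • ((1 : ℝ), (0 : ℝ)) + h.2 • ((0 : ℝ), (1 : ℝ)) := by simp
  have hk : k = k.1 • ((1 : ℝ), (0 : ℝ)) + k.2 • ((0 : ℝ), (1 : ℝ)) := by simp
  rw [huu, hvu, hvv]
  conv_lhs => rw [hh, hk]
  simp only [map_add, map_smul, add_apply, smul_apply,
    hsymm]
  module

lemma nproj_add (x : ℝ × ℝ → V4) (p : ℝ × ℝ) (v w : V4) :
    nproj x (v + w) p = nproj x v p + nproj x w p := by
  simp only [nproj, ip_add_left, add_div]
  module

lemma nproj_smul (x : ℝ × ℝ → V4) (p : ℝ × ℝ) (r : ℝ) (w : V4) :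
    nproj x (r • w) p = r • nproj x w p := by
  simp only [nproj, ip_smul_left, mul_div_assoc]
  module

lemma nproj_pu {D : Set (ℝ × ℝ)} {x : ℝ × ℝ → V4} (hiso : IsTimelikeIso D x) {p : ℝ × ℝ}
    (hp : p ∈ D) : nproj x (pu x p) p = 0 := by
  obtain ⟨hE, -, huv⟩ := hiso p hp
  have : ip (pu x p) (pu x p) / Ef x p = 1 := div_self hE.ne
  simp [nproj, this, huv]

lemma nproj_pv {D : Set (ℝ × ℝ)} {x : ℝ × ℝ → V4} (hiso : IsTimelikeIso D x) {p : ℝ × ℝ}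
    (hp : p ∈ D) : nproj x (pv x p) p = 0 := by
  obtain ⟨hE, hvv, huv⟩ := hiso p hp
  have : ip (pv x p) (pv x p) / Ef x p = -1 := by rw [hvv, neg_div, div_self hE.ne]
  simp [nproj, this, ip_comm (pv x p) (pu x p), huv]

/-- The normal projection only depends on the tangent plane. -/
lemma nproj_eq_of_conformal {x y : ℝ × ℝ → V4} {a b : ℝ × ℝ} {p q σ : ℝ} (hσ : σ = 1 ∨ σ = -1)
    (hpq : p ^ 2 - q ^ 2 ≠ 0) (hE : Ef y b = Ef x a * (p ^ 2 - q ^ 2))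
    (hE0 : Ef x a ≠ 0)
    (hu : pu y b = p • pu x a + q • pv x a) (hv : pv y b = (σ * q) • pu x a + (σ * p) • pv x a)
    (w : V4) : nproj y w b = nproj x w a := by
  have hσ2 : σ ^ 2 = 1 := by rcases hσ with rfl | rfl <;> norm_num
  simp only [nproj, hE, hu, hv, ip_add_right, ip_smul_right]
  generalize ip w (pu x a) = m
  generalize ip w (pv x a) = n
  generalize Ef x a = E at *
  ext i
  simp only [Pi.add_apply, Pi.sub_apply, Pi.smul_apply, smul_eq_mul]
  field_simp
  linear_combination (q * pu x a i + p * pv x a i) * (q * m + p * n) * hσ2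

/-- At each point, a change of canonical coordinates has differential `±1` or, for `ε₁ = 0`,
`±` conjugation. -/
lemma fderiv_canonical_change {D D' : Set (ℝ × ℝ)} (hD : IsOpen D) (hD' : IsOpen D')
    {x : ℝ × ℝ → V4} (hx : ContDiffOn ℝ 2 x D)
    (hiso : IsTimelikeIso D x) (hmin : IsMinimal D x) {e0 e1 : ℝ}
    (hpar : (e0, e1) = (1, 0) ∨ (e0, e1) = (-1, 0) ∨ (e0, e1) = (0, 1))
    (hcan : Canonical D x e0 e1)
    {F : ℝ × ℝ → ℝ × ℝ} (hF : ContDiffOn ℝ 2 F D') (hmap : Set.MapsTo F D' D)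
    (hiso' : IsTimelikeIso D' (fun s => x (F s)))
    (hcan' : Canonical D' (fun s => x (F s)) e0 e1) {s : ℝ × ℝ} (hs : s ∈ D') :
    ∃ δ σ : ℝ, (δ = 1 ∨ δ = -1) ∧ (σ = 1 ∨ σ = -1) ∧ (e1 = 0 ∨ σ = 1) ∧
      pu F s = (δ, 0) ∧ pv F s = (0, σ * δ) := by
  have hFs : ContDiffAt ℝ 2 F s := hF.contDiffAt (hD'.mem_nhds hs)
  have hxs : ContDiffAt ℝ 2 x (F s) := hx.contDiffAt (hD.mem_nhds (hmap hs))
  obtain ⟨hE, hvv, huv⟩ := hiso _ (hmap hs)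
  obtain ⟨hE', hvv', huv'⟩ := hiso' s hs
  obtain ⟨hc0, hc1⟩ := hcan _ (hmap hs)
  obtain ⟨hc0', hc1'⟩ := hcan' s hs
  have hxvv : pv (pv x) (F s) = pu (pu x) (F s) := (sub_eq_zero.mp (hmin _ (hmap hs))).symm
  have hd (v : ℝ × ℝ) : fderiv ℝ (fun s => x (F s)) s v =
      (fderiv ℝ F s v).1 • pu x (F s) + (fderiv ℝ F s v).2 • pv x (F s) := by
    rw [← fderiv_apply_eq_pu_pv]
    exact congrArg (fun L => L v)
      (fderiv_comp s (hxs.differentiableAt (by simp)) (hFs.differentiableAt (by simp)))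
  have hyu : pu (fun s => x (F s)) s = (pu F s).1 • pu x (F s) + (pu F s).2 • pv x (F s) := hd _
  have hyv : pv (fun s => x (F s)) s = (pv F s).1 • pu x (F s) + (pv F s).2 • pv x (F s) := hd _
  have hyuu := fderiv_fderiv_comp_apply hxs hFs (1, 0) (1, 0)
  have hyuv := fderiv_fderiv_comp_apply hxs hFs (1, 0) (0, 1)
  rw [fderiv_fderiv_eq_pu_pv hxs, fderiv_apply_eq_pu_pv x, hxvv] at hyuu hyuv
  change pu (pu fun s => x (F s)) s = _ at hyuu
  change pv (pu fun s => x (F s)) s = _ at hyuv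
  change _ = ((pu F s).1 * (pu F s).1) • _ + ((pu F s).1 * (pu F s).2 + (pu F s).2 * (pu F s).1) • _
    + ((pu F s).2 * (pu F s).2) • _ + _ at hyuu
  change _ = ((pv F s).1 * (pu F s).1) • _ + ((pv F s).1 * (pu F s).2 + (pv F s).2 * (pu F s).1) • _
    + ((pv F s).2 * (pu F s).2) • _ + _ at hyuv
  have hEy : Ef (fun s => x (F s)) s = Ef x (F s) * ((pu F s).1 ^ 2 - (pu F s).2 ^ 2) := by
    rw [Ef, hyu]
    simp only [ip_add_left, ip_add_right, ip_smul_left, ip_smul_right, hvv,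
      ip_comm (pv x (F s)) (pu x (F s)), huv]
    rw [← Ef]; ring
  have hvvy : ip (pv (fun s => x (F s)) s) (pv (fun s => x (F s)) s) =
      Ef x (F s) * ((pv F s).1 ^ 2 - (pv F s).2 ^ 2) := by
    rw [hyv]
    simp only [ip_add_left, ip_add_right, ip_smul_left, ip_smul_right, hvv,
      ip_comm (pv x (F s)) (pu x (F s)), huv]
    rw [← Ef]; ring
  have huvy : ip (pu (fun s => x (F s)) s) (pv (fun s => x (F s)) s) =
      Ef x (F s) * ((pu F s).1 * (pv F s).1 - (pu F s).2 * (pv F s).2) := by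
    rw [hyu, hyv]
    simp only [ip_add_left, ip_add_right, ip_smul_left, ip_smul_right, hvv,
      ip_comm (pv x (F s)) (pu x (F s)), huv]
    rw [← Ef]; ring
  rw [hEy] at hE' hvv'
  rw [hvvy] at hvv'
  rw [huvy] at huv'
  obtain ⟨σ, hσ, hr, ht⟩ := hyperbolic_cauchy_riemann hE hE' hvv' huv'
  have hpq : 0 < (pu F s).1 ^ 2 - (pu F s).2 ^ 2 := by nlinarith
  rw [hr, ht] at hyv hyuv
  have hproj := nproj_eq_of_conformal hσ hpq.ne' hEy hE.ne hyu hyv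
  have hA : sffA (fun s => x (F s)) s =
      ((pu F s).1 ^ 2 + (pu F s).2 ^ 2) • sffA x (F s) +
        (2 * (pu F s).1 * (pu F s).2) • sffB x (F s) := by
    rw [sffA, hproj, hyuu]
    simp only [nproj_add, nproj_smul, nproj_pu hiso (hmap hs), nproj_pv hiso (hmap hs)]
    rw [← sffA, ← sffB]
    module
  have hB : sffB (fun s => x (F s)) s =
      (σ * (2 * (pu F s).1 * (pu F s).2)) • sffA x (F s) +
        (σ * ((pu F s).1 ^ 2 + (pu F s).2 ^ 2)) • sffB x (F s) := by
    rw [sffB, hproj, hyuv]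
    simp only [nproj_add, nproj_smul, nproj_pu hiso (hmap hs), nproj_pv hiso (hmap hs)]
    rw [← sffA, ← sffB]
    module
  have hσ2 : σ ^ 2 = 1 := by rcases hσ with rfl | rfl <;> norm_num
  rw [hA, hB] at hc0' hc1'
  simp only [ip_add_left, ip_add_right, ip_smul_left, ip_smul_right,
    ip_comm (sffB x (F s)) (sffA x (F s))] at hc0' hc1'
  generalize ip (sffA x (F s)) (sffA x (F s)) = aa at *
  generalize ip (sffA x (F s)) (sffB x (F s)) = ab at *
  generalize ip (sffB x (F s)) (sffB x (F s)) = bb at *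
  generalize hp : (pu F s).1 = p at *
  generalize hq : (pu F s).2 = q at *
  obtain ⟨rfl, hδ, he⟩ := canonical_rigidity (e0 := e0) (e1 := e1) hσ hpq hpar
    (by
      rw [← hc0, ← hc1] at *
      linear_combination hc0' - ((2 * p * q) ^ 2 * aa + 2 * (2 * p * q) * (p ^ 2 + q ^ 2) * ab
        + (p ^ 2 + q ^ 2) ^ 2 * bb) * hσ2)
    (by
      rw [← hc0, ← hc1] at *
      linear_combination hc1')
  exact ⟨p, σ, hδ, hσ, he, Prod.ext hp hq, Prod.ext (by simpa using hr) ht⟩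

/-- Uniqueness of canonical coordinates. Any reparametrization between
canonical coordinates with the same parameters is `t = ±s + c` or (only in the first or
second type, `ε₁ = 0`) `t = ±s̄ + c`. -/
theorem stmt_11 (D D' : Set (ℝ × ℝ)) (hD : IsOpen D) (hDconn : IsConnected D)
    (hD' : IsOpen D') (hD'conn : IsConnected D')
    (x : ℝ × ℝ → V4) (hx : ContDiffOn ℝ (⊤ : ℕ∞) x D)
    (hiso : IsTimelikeIso D x) (hmin : IsMinimal D x)
    (e0 e1 : ℝ)
    (hpar : (e0, e1) = (1, 0) ∨ (e0, e1) = (-1, 0) ∨ (e0, e1) = (0, 1))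
    (hcan : Canonical D x e0 e1)
    (F : ℝ × ℝ → ℝ × ℝ) (hF : ContDiffOn ℝ 2 F D')
    (hmap : Set.MapsTo F D' D) (hinj : Set.InjOn F D')
    (hjac : ∀ s ∈ D',
      pu (fun r => (F r).1) s * pv (fun r => (F r).2) s -
        pv (fun r => (F r).1) s * pu (fun r => (F r).2) s ≠ 0)
    (hiso' : IsTimelikeIso D' (fun s => x (F s)))
    (hmin' : IsMinimal D' (fun s => x (F s)))
    (hcan' : Canonical D' (fun s => x (F s)) e0 e1) :
    ∃ δ c₁ c₂ : ℝ, (δ = 1 ∨ δ = -1) ∧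
      ((∀ s ∈ D', F s = (δ * s.1 + c₁, δ * s.2 + c₂)) ∨
       (e1 = 0 ∧ ∀ s ∈ D', F s = (δ * s.1 + c₁, -δ * s.2 + c₂))) := by
  have hpt := fun s hs => fderiv_canonical_change hD hD' (hx.of_le (WithTop.coe_le_coe.mpr le_top))
    hiso hmin hpar hcan hF hmap hiso' hcan' (s := s) hs
  have hcont : ContinuousOn (fderiv ℝ F) D' :=
    hF.continuousOn_fderiv_of_isOpen hD' (by norm_num)
  have hT : IsDiscrete ({1, -1} : Set ℝ) := (Set.toFinite _).isDiscrete
  obtain ⟨δ, hδ, hδF⟩ := hD'conn.isPreconnected.eqOn_const_of_mapsTo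
    hT (f := fun s => (pu F s).1)
    ((hcont.clm_apply continuousOn_const).fst)
    (fun s hs => by
      obtain ⟨δ, σ, hδ, -, -, hu, -⟩ := hpt s hs
      simpa [hu] using hδ) ⟨1, by simp⟩
  obtain ⟨τ, -, hτF⟩ := hD'conn.isPreconnected.eqOn_const_of_mapsTo
    hT (f := fun s => (pv F s).2)
    ((hcont.clm_apply continuousOn_const).snd)
    (fun s hs => by
      obtain ⟨δ, σ, hδ, hσ, -, -, hv⟩ := hpt s hs
      rcases hδ with rfl | rfl <;> rcases hσ with rfl | rfl <;> simp [hv]) ⟨1, by simp⟩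
  have hδ' : δ = 1 ∨ δ = -1 := by simpa using hδ
  let L : ℝ × ℝ →L[ℝ] ℝ × ℝ :=
    (δ • ContinuousLinearMap.fst ℝ ℝ ℝ).prod (τ • ContinuousLinearMap.snd ℝ ℝ ℝ)
  have hL : D'.EqOn (fderiv ℝ F) (fderiv ℝ L) := by
    intro s hs
    obtain ⟨δ₁, σ, -, -, -, hu, hv⟩ := hpt s hs
    have h1 : (pu F s).1 = δ := hδF hs
    have h2 : (pv F s).2 = τ := hτF hs
    rw [hu] at h1
    rw [hv] at h2
    refine ContinuousLinearMap.ext fun h => ?_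
    rw [fderiv_apply_eq_pu_pv F, hu, hv, L.fderiv]
    ext
    · simp [L, ← h1, mul_comm]
    · simp [L, ← h2, mul_comm]
  obtain ⟨c, hc⟩ := hD'.exists_eq_add_of_fderiv_eq hD'conn.isPreconnected
    (hF.differentiableOn (by simp)) L.differentiable.differentiableOn hL
  have hFc : ∀ s ∈ D', F s = (δ * s.1 + c.1, τ * s.2 + c.2) := fun s hs => by
    rw [hc hs]; rfl
  obtain ⟨s₀, hs₀⟩ := hD'conn.nonempty
  obtain ⟨δ₁, σ, -, hσ, he, hu, hv⟩ := hpt s₀ hs₀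
  have h1 : (pu F s₀).1 = δ := hδF hs₀
  have h2 : (pv F s₀).2 = τ := hτF hs₀
  rw [hu] at h1
  rw [hv] at h2
  dsimp only at h1 h2
  subst h1 h2
  refine ⟨δ₁, c.1, c.2, hδ', ?_⟩
  rcases hσ with rfl | rfl
  · exact Or.inl (by simpa using hFc)
  · exact Or.inr ⟨he.resolve_right (by norm_num), by simpa using hFc⟩
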